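/- arXiv:2207.13484 — 2 statements merged into one kernel-verified Lean document; each statement's English description precedes it below -/
import Mathlib

section
/- Let A be a C*-algebra and 𝒜 a dense *-subalgebra of A that is spectral invariant (i.e., for every a ∈ 𝒜 the spectrum of a in 𝒜 equals the spectrum of a in A). Let B be a C*-algebra, 𝓑 ⊆ B a dense *-subalgebra, and 𝒳 a right inner product 𝓑-module which is also a left 𝒜-module satisfying ⟨a·x, y⟩_𝓑 = ⟨x, a*·y⟩_𝓑 for all x, y ∈ 𝒳 and a ∈ 𝒜. Then for all a ∈ 𝒜 and x ∈ 𝒳 the inequality ⟨a·x, a·x⟩_𝓑 ≤ ‖a‖_A² · ⟨x, x⟩_𝓑 holds in the C*-algebra B. -/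
open Polynomial Filter Topology in
/-- A nonnegative real polynomial attains its minimum at a double root of `P - min P`. -/
theorem Polynomial.exists_eq_C_add_sq_mul_of_eval_nonneg {P : ℝ[X]} (hdeg : 0 < P.degree)
    (hP : ∀ x, 0 ≤ P.eval x) :
    ∃ (r c : ℝ) (Q : ℝ[X]), 0 ≤ c ∧ (∀ x, 0 ≤ Q.eval x) ∧ P = C c + (X - C r) ^ 2 * Q := by
  have htend : Tendsto (fun x => P.eval x) (cocompact ℝ) atTop := by
    rw [cocompact_eq_atBot_atTop, tendsto_sup]
    constructor
    · simpa only [abs_of_nonneg (hP _)] using P.abs_tendsto_atBot hdeg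
    · simpa only [abs_of_nonneg (hP _)] using P.abs_tendsto_atTop hdeg
  obtain ⟨r, hr⟩ := P.continuous.exists_forall_le htend
  obtain ⟨Q₁, hQ₁⟩ : X - C r ∣ P - C (P.eval r) := dvd_iff_isRoot.2 (by simp)
  have hder : P.derivative.eval r = 0 := by
    rw [← P.deriv]
    exact IsLocalMin.deriv_eq_zero (Eventually.of_forall hr)
  have hroot : Q₁.IsRoot r := by
    have h := congrArg (fun p : ℝ[X] => p.derivative.eval r) hQ₁
    simpa [hder, eq_comm] using h
  obtain ⟨Q, rfl⟩ := dvd_iff_isRoot.2 hroot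
  have hPQ : P = C (P.eval r) + (X - C r) ^ 2 * Q := by linear_combination hQ₁
  refine ⟨r, P.eval r, Q, hP r, ?_, hPQ⟩
  have hclosed : IsClosed {x | 0 ≤ Q.eval x} := isClosed_le continuous_const Q.continuous
  have hsub : ({r}ᶜ : Set ℝ) ⊆ {x | 0 ≤ Q.eval x} := by
    intro x hx
    have h := congrArg (eval x) hPQ
    simp only [eval_add, eval_C, eval_mul, eval_pow, eval_sub, eval_X] at h
    have hpos : 0 < (x - r) ^ 2 := sq_pos_of_ne_zero (sub_ne_zero.2 hx)
    exact nonneg_of_mul_nonneg_right (by linarith [hr x]) hpos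
  intro x
  exact hclosed.closure_subset_iff.2 hsub (dense_compl_singleton r x)

open Polynomial in
/-- A real polynomial that is nonnegative on the line is a sum of squares. -/
theorem Polynomial.isSumSq_of_eval_nonneg (P : ℝ[X]) (hP : ∀ x, 0 ≤ P.eval x) : IsSumSq P := by
  have hC : ∀ c : ℝ, 0 ≤ c → IsSumSq (C c) := fun c hc => by
    rw [← Real.mul_self_sqrt hc, C_mul]
    exact IsSumSq.mul_self _
  induction hn : P.natDegree using Nat.strong_induction_on generalizing P with
  | _ n ih =>
    rcases le_or_gt P.degree 0 with hdeg | hdeg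
    · rw [eq_C_of_degree_le_zero hdeg]
      exact hC _ (by simpa [coeff_zero_eq_eval_zero] using hP 0)
    · obtain ⟨r, c, Q, hc, hQ, rfl⟩ := exists_eq_C_add_sq_mul_of_eval_nonneg hdeg hP
      have hQ0 : Q ≠ 0 := by
        rintro rfl
        rw [mul_zero, add_zero] at hdeg
        exact absurd degree_C_le (not_le.2 hdeg)
      refine (hC c hc).add ?_
      have hlt : Q.natDegree < n := by
        rw [← hn, add_comm, natDegree_add_C, ((monic_X_sub_C r).pow 2).natDegree_mul' hQ0,
          (monic_X_sub_C r).natDegree_pow, natDegree_X_sub_C]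
        lia
      have hsum := ih _ hlt Q hQ rfl
      clear hdeg hP hn hlt hQ0 hQ ih
      induction hsum with
      | zero => simp
      | sq_add q _ ihq =>
        rw [mul_add, show (X - C r) ^ 2 * (q * q) = ((X - C r) * q) * ((X - C r) * q) by ring]
        exact (IsSumSq.mul_self _).add ihq

section PositiveMap

open Polynomial

variable {R B : Type*} [Ring R] [Algebra ℝ R] [NormedAddCommGroup B]
  [NormedSpace ℝ B]

/-- The fraction `P / D ^ 2` dominates the indicator function of `[p, q]`, and `T` maps its value
at `k` to an element of norm at most `η`. -/
def HasSmallCover (T : R →ₗ[ℝ] B) (k : R) (p q η : ℝ) : Prop :=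
  ∃ (P D : ℝ[X]) (u : Rˣ), (u : R) = aeval k D ∧ (∀ x, 0 ≤ P.eval x) ∧
    (∀ x ∈ Set.Icc p q, D.eval x ^ 2 ≤ P.eval x) ∧
    ‖T (↑u⁻¹ * aeval k P * ↑u⁻¹)‖ ≤ η

theorem Units.commute_inv_aeval {k : R} {D : ℝ[X]} {u : Rˣ} (hu : (u : R) = aeval k D)
    (Q : ℝ[X]) : Commute (↑u⁻¹ : R) (aeval k Q) := by
  refine Commute.units_inv_left ?_
  rw [hu]
  exact Commute.map (Commute.all D Q) (aeval k)

theorem Units.inv_mul_aeval_mul_sq_mul_inv {k : R} {D : ℝ[X]} {u : Rˣ}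
    (hu : (u : R) = aeval k D) (Q : ℝ[X]) :
    (↑u⁻¹ : R) * aeval k (Q * D ^ 2) * ↑u⁻¹ = aeval k Q := by
  rw [show Q * D ^ 2 = D * Q * D by ring, map_mul, map_mul, ← hu]
  simp [mul_assoc]

theorem HasSmallCover.union {T : R →ₗ[ℝ] B} {k : R} {p q r η₁ η₂ : ℝ}
    (h₁ : HasSmallCover T k p q η₁) (h₂ : HasSmallCover T k q r η₂) :
    HasSmallCover T k p r (η₁ + η₂) := by
  obtain ⟨P₁, D₁, u₁, hu₁, hP₁, hPD₁, hT₁⟩ := h₁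
  obtain ⟨P₂, D₂, u₂, hu₂, hP₂, hPD₂, hT₂⟩ := h₂
  have hcomm : u₁ * u₂ = u₂ * u₁ := by
    ext
    simp only [Units.val_mul, hu₁, hu₂, ← map_mul, mul_comm]
  have e₁ : (↑(u₁ * u₂)⁻¹ : R) * aeval k (P₁ * D₂ ^ 2) * ↑(u₁ * u₂)⁻¹ =
      ↑u₁⁻¹ * aeval k P₁ * ↑u₁⁻¹ := by
    rw [← Units.inv_mul_aeval_mul_sq_mul_inv hu₂ P₁]
    nth_rw 1 [hcomm]
    simp only [mul_inv_rev, Units.val_mul, mul_assoc]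
  have e₂ : (↑(u₁ * u₂)⁻¹ : R) * aeval k (P₂ * D₁ ^ 2) * ↑(u₁ * u₂)⁻¹ =
      ↑u₂⁻¹ * aeval k P₂ * ↑u₂⁻¹ := by
    rw [← Units.inv_mul_aeval_mul_sq_mul_inv hu₁ P₂]
    nth_rw 2 [hcomm]
    simp only [mul_inv_rev, Units.val_mul, mul_assoc]
  refine ⟨P₁ * D₂ ^ 2 + P₂ * D₁ ^ 2, D₁ * D₂, u₁ * u₂, by simp [hu₁, hu₂], ?_, ?_, ?_⟩
  · intro x
    have := hP₁ x
    have := hP₂ x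
    simp only [eval_add, eval_mul, eval_pow]
    positivity
  · intro x hx
    simp only [eval_add, eval_mul, eval_pow, mul_pow]
    rcases le_total x q with hxq | hxq
    · nlinarith [mul_le_mul_of_nonneg_right (hPD₁ x ⟨hx.1, hxq⟩) (sq_nonneg (D₂.eval x)),
        mul_nonneg (hP₂ x) (sq_nonneg (D₁.eval x))]
    · nlinarith [mul_le_mul_of_nonneg_right (hPD₂ x ⟨hxq, hx.2⟩) (sq_nonneg (D₁.eval x)),
        mul_nonneg (hP₁ x) (sq_nonneg (D₂.eval x))]
  · rw [map_add, mul_add, add_mul, e₁, e₂, map_add]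
    exact (norm_add_le _ _).trans (add_le_add hT₁ hT₂)

/-- Around a point where the resolvent of `k` exists, short intervals have covers whose size is
of smaller order than their length. -/
theorem exists_hasSmallCover_of_isUnit (T : R →ₗ[ℝ] B) {k : R} {t : ℝ}
    (hk : IsUnit (k - algebraMap ℝ R t)) {η : ℝ} (hη : 0 < η) :
    ∃ δ > 0, ∀ p q, p ≤ t → t ≤ q → q - p ≤ δ → HasSmallCover T k p q (η * (q - p)) := by
  obtain ⟨u, hu⟩ := hk
  set K := ‖T (↑u⁻¹ * ↑u⁻¹)‖ with hK
  have hK0 : 0 ≤ K := norm_nonneg _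
  refine ⟨η / (K + 1), by positivity, fun p q hp hq hpq => ?_⟩
  refine ⟨C ((q - p) ^ 2), X - C t, u, by simp [hu], fun x => by simp; positivity, ?_, ?_⟩
  · intro x hx
    simp only [eval_sub, eval_X, eval_C]
    exact sq_le_sq' (by linarith [hx.1]) (by linarith [hx.2])
  · rw [aeval_C, ← Algebra.commutes, mul_assoc, ← Algebra.smul_def, map_smul, norm_smul, ← hK,
      Real.norm_of_nonneg (sq_nonneg _)]
    rw [le_div_iff₀ (by positivity)] at hpq
    nlinarith [mul_le_mul_of_nonneg_left hpq (by linarith : 0 ≤ q - p),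
      sq_nonneg (q - p)]

theorem hasSmallCover_of_isUnit (T : R →ₗ[ℝ] B) {k : R} {p q : ℝ} (hpq : p ≤ q)
    (hk : ∀ t ∈ Set.Icc p q, IsUnit (k - algebraMap ℝ R t)) {η : ℝ} (hη : 0 < η) :
    HasSmallCover T k p q (η * (q - p)) := by
  let S : Set ℝ := {t | t ∈ Set.Icc p q ∧ HasSmallCover T k p t (η * (t - p))}
  have hpS : p ∈ S := by
    obtain ⟨δ, hδ, h⟩ := exists_hasSmallCover_of_isUnit T (hk p ⟨le_rfl, hpq⟩) hη
    exact ⟨⟨le_rfl, hpq⟩, h p p le_rfl le_rfl (by linarith)⟩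
  have hbdd : BddAbove S := ⟨q, fun t ht => ht.1.2⟩
  set s := sSup S
  have hps : p ≤ s := le_csSup hbdd hpS
  have hsq : s ≤ q := csSup_le ⟨p, hpS⟩ fun t ht => ht.1.2
  obtain ⟨δ, hδ, h⟩ := exists_hasSmallCover_of_isUnit T (hk s ⟨hps, hsq⟩) hη
  obtain ⟨t, ht, hst⟩ := exists_lt_of_lt_csSup ⟨p, hpS⟩ (show s - δ / 2 < s by linarith)
  have hts : t ≤ s := le_csSup hbdd ht
  have extend : ∀ r, s ≤ r → r ≤ s + δ / 2 → r ≤ q → r ∈ S := fun r hsr hr hrq => by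
    refine ⟨⟨hps.trans hsr, hrq⟩, ?_⟩
    have := ht.2.union (h t r hts hsr (by linarith))
    rwa [show η * (t - p) + η * (r - t) = η * (r - p) by ring] at this
  have hmin : min q (s + δ / 2) ∈ S :=
    extend _ (le_min hsq (by linarith)) (min_le_right _ _) (min_le_left _ _)
  have hle : min q (s + δ / 2) ≤ s := le_csSup hbdd hmin
  rcases min_le_iff.1 hle with hqs | hbad
  · exact (extend q hsq (by linarith) le_rfl).2
  · linarith

variable [StarRing R] [StarModule ℝ R]

theorem IsSelfAdjoint.star_aeval_real {k : R} (hk : IsSelfAdjoint k) (P : ℝ[X]) :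
    star (aeval k P) = aeval k P := by
  induction P using Polynomial.induction_on' with
  | add p q hp hq => simp [hp, hq]
  | monomial n r => simp [aeval_monomial, hk.star_eq, Algebra.commutes, ← algebraMap_star_comm]

variable [PartialOrder B] [IsOrderedAddMonoid B]

theorem map_inv_mul_aeval_mul_inv_nonneg {T : R →ₗ[ℝ] B} (hT : ∀ a, 0 ≤ T (star a * a)) {k : R}
    (hk : IsSelfAdjoint k) {W D : ℝ[X]} {u : Rˣ} (hu : (u : R) = aeval k D)
    (hW : ∀ x, 0 ≤ W.eval x) : 0 ≤ T (↑u⁻¹ * aeval k W * ↑u⁻¹) := by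
  have hstar : star (↑u⁻¹ : R) = ↑u⁻¹ := by
    have : star u = u := Units.ext (by simpa [hu] using hk.star_aeval_real D)
    rw [← Units.coe_star, star_inv, this]
  have hsum := isSumSq_of_eval_nonneg W hW
  clear hW
  induction hsum with
  | zero => simp
  | sq_add a _ ih =>
    rw [map_add, mul_add, add_mul, map_add]
    refine add_nonneg ?_ ih
    have := hT (aeval k a * ↑u⁻¹)
    rwa [star_mul, hk.star_aeval_real, hstar, ← mul_assoc, mul_assoc (↑u⁻¹ : R), ← map_mul] at this

/-- A map that is positive on hermitian squares is nonnegative at every self-adjoint element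
without negative spectrum. -/
theorem map_nonneg_of_forall_neg_isUnit [OrderClosedTopology B] {T : R →ₗ[ℝ] B}
    (hT : ∀ a, 0 ≤ T (star a * a)) {k : R} (hk : IsSelfAdjoint k)
    (hunit : ∀ r : ℝ, r < 0 → IsUnit (k - algebraMap ℝ R r)) : 0 ≤ T k := by
  have hclosed : IsClosed {b : B | 0 ≤ b} := isClosed_le continuous_const continuous_id
  refine hclosed.closure_subset_iff.2 subset_rfl (Metric.mem_closure_iff.2 fun ρ hρ => ?_)
  set K := ‖T (k ^ 2 + 1)‖
  have hK : 0 ≤ K := norm_nonneg _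
  obtain ⟨ε, hε0, hε⟩ : ∃ ε > 0, ε < min 1 (ρ / 2 / (K + 1)) := exists_between (by positivity)
  have hε1 : ε < 1 := hε.trans_le (min_le_left _ _)
  have hεK : ε * K < ρ / 2 := by
    have := (lt_div_iff₀ (by positivity)).1 (hε.trans_le (min_le_right _ _))
    linarith
  have hinv : 1 < ε⁻¹ := (one_lt_inv₀ hε0).2 hε1
  have hlen : 0 < -ε - -ε⁻¹ := by linarith
  obtain ⟨P, D, u, hu, hP, hPD, hPT⟩ := hasSmallCover_of_isUnit T (k := k) (by linarith)
    (fun t ht => hunit t (by linarith [ht.2])) (p := -ε⁻¹) (q := -ε)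
    (η := ρ / 2 * ε / (-ε - -ε⁻¹)) (by positivity)
  rw [div_mul_cancel₀ _ hlen.ne'] at hPT
  set f := (↑u⁻¹ : R) * aeval k P * ↑u⁻¹
  have key : 0 ≤ T (ε⁻¹ • f + (k + ε • (k ^ 2 + 1))) := by
    have := map_inv_mul_aeval_mul_inv_nonneg hT hk hu
      (W := C ε⁻¹ * P + (X + C ε * (X ^ 2 + 1)) * D ^ 2) fun x => ?_
    · rwa [map_add, mul_add, add_mul, Units.inv_mul_aeval_mul_sq_mul_inv hu, ← smul_eq_C_mul,
        map_smul, mul_smul_comm, smul_mul_assoc, map_add (aeval k), aeval_X, ← smul_eq_C_mul, map_smul,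
        map_add (aeval k), map_pow, aeval_X, map_one] at this
    · simp only [eval_add, eval_mul, eval_C, eval_X, eval_pow, eval_one]
      have hPx := hP x
      have hD := sq_nonneg (D.eval x)
      have hinv0 : 0 ≤ ε⁻¹ := by positivity
      by_cases hx : x ∈ Set.Icc (-ε⁻¹) (-ε)
      · have h1 := mul_le_mul_of_nonneg_left (hPD x hx) hinv0
        have h2 : 0 ≤ (ε⁻¹ + x + ε * (x ^ 2 + 1)) * D.eval x ^ 2 :=
          mul_nonneg (add_nonneg (by linarith [hx.1]) (by positivity)) hD
        linarith
      · refine add_nonneg (mul_nonneg hinv0 hPx) (mul_nonneg ?_ hD)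
        rcases lt_or_ge x (-ε⁻¹) with h | h
        · have hεx : ε * x < -1 := by
            have := mul_lt_mul_of_pos_left h hε0
            rwa [mul_neg, mul_inv_cancel₀ hε0.ne'] at this
          nlinarith
        · have : -ε < x := lt_of_not_ge fun h' => hx ⟨h, h'⟩
          nlinarith [mul_nonneg hε0.le (sq_nonneg x)]
  refine ⟨_, key, ?_⟩
  rw [dist_comm, dist_eq_norm, ← map_sub,
    show ε⁻¹ • f + (k + ε • (k ^ 2 + 1)) - k = ε⁻¹ • f + ε • (k ^ 2 + 1) by abel, map_add, map_smul,
    map_smul]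
  calc ‖ε⁻¹ • T f + ε • T (k ^ 2 + 1)‖ ≤ ε⁻¹ * ‖T f‖ + ε * K := by
        refine (norm_add_le _ _).trans_eq ?_
        rw [norm_smul, norm_smul, Real.norm_of_nonneg hε0.le,
          Real.norm_of_nonneg (inv_nonneg.2 hε0.le)]
    _ ≤ ε⁻¹ * (ρ / 2 * ε) + ε * K := by gcongr
    _ = ρ / 2 + ε * K := by field_simp
    _ < ρ := by linarith

end PositiveMap

theorem StarSubalgebra.isUnit_norm_sq_sub_star_mul_self_sub {A : Type*}
    [NormedRing A] [StarRing A] [CStarRing A] [NormedAlgebra ℂ A] [CompleteSpace A]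
    [StarModule ℂ A] {𝒜 : StarSubalgebra ℂ A} (hspec : ∀ a : 𝒜, spectrum ℂ a = spectrum ℂ (a : A)) (a : 𝒜)
    {r : ℝ} (hr : r < 0) :
    IsUnit (algebraMap ℝ 𝒜 (‖(a : A)‖ ^ 2) - star a * a - algebraMap ℝ 𝒜 r) := by
  have hnot : ((‖(a : A)‖ ^ 2 - r : ℝ) : ℂ) ∉ spectrum ℂ (star a * a) := by
    rw [hspec]
    intro h
    have h1 := spectrum.norm_le_norm_mul_of_mem h
    have h2 : ‖(1 : A)‖ ≤ 1 := by
      rcases subsingleton_or_nontrivial A with _ | _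
      · simp [Subsingleton.elim (1 : A) 0]
      · exact CStarRing.norm_one.le
    have h3 : ‖((star a * a : 𝒜) : A)‖ = ‖(a : A)‖ ^ 2 := by
      rw [sq]
      exact CStarRing.norm_star_mul_self
    rw [h3, Complex.norm_real] at h1
    have h4 := (Real.le_norm_self _).trans h1
    nlinarith [sq_nonneg ‖(a : A)‖]
  have := spectrum.notMem_iff.1 hnot
  have e : algebraMap ℝ 𝒜 (‖(a : A)‖ ^ 2) - star a * a - algebraMap ℝ 𝒜 r =
      algebraMap ℂ 𝒜 ((‖(a : A)‖ ^ 2 - r : ℝ) : ℂ) - star a * a := by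
    rw [← Complex.coe_algebraMap, ← IsScalarTower.algebraMap_apply ℝ ℂ 𝒜, map_sub]
    abel
  rwa [e]

/-- If `𝒜 ⊆ A` is a dense spectral-invariant *-subalgebra of a C*-algebra `A`,
`𝓑 ⊆ B` a dense *-subalgebra of a C*-algebra `B`, and `𝒳` a right inner product `𝓑`-module
which is also a left `𝒜`-module satisfying `⟨a·x, y⟩_𝓑 = ⟨x, a*·y⟩_𝓑`, then
`⟨a·x, a·x⟩_𝓑 ≤ ‖a‖_A² ⟨x,x⟩_𝓑` in `B`. -/
theorem stmt0
    {A B X : Type*}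
    [NormedRing A] [StarRing A] [CStarRing A] [NormedAlgebra ℂ A] [CompleteSpace A]
    [StarModule ℂ A]
    [NormedRing B] [StarRing B] [CStarRing B] [NormedAlgebra ℂ B] [CompleteSpace B]
    [StarModule ℂ B] [PartialOrder B] [StarOrderedRing B]
    [AddCommGroup X] [Module ℂ X]
    (𝒜 : StarSubalgebra ℂ A) (h𝒜dense : Dense (𝒜 : Set A))
    (hspec : ∀ a : 𝒜, spectrum ℂ a = spectrum ℂ (a : A))
    (𝓑 : StarSubalgebra ℂ B) (h𝓑dense : Dense (𝓑 : Set B))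
    -- right `𝓑`-module structure
    (rsmul : X → 𝓑 → X)
    (hr_addl : ∀ x y b, rsmul (x + y) b = rsmul x b + rsmul y b)
    (hr_addr : ∀ x b b', rsmul x (b + b') = rsmul x b + rsmul x b')
    (hr_mul : ∀ x b b', rsmul x (b * b') = rsmul (rsmul x b) b')
    (hr_one : ∀ x, rsmul x 1 = x)
    -- `𝓑`-valued inner product (linear in the second variable)
    (ip : X → X → B)
    (hip_mem : ∀ x y, ip x y ∈ 𝓑)
    (hip_addl : ∀ x y z, ip (x + y) z = ip x z + ip y z)
    (hip_addr : ∀ x y z, ip x (y + z) = ip x y + ip x z)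
    (hip_smul : ∀ (c : ℂ) (x y : X), ip x (c • y) = c • ip x y)
    (hip_star : ∀ x y, star (ip x y) = ip y x)
    (hip_mod : ∀ x y b, ip x (rsmul y b) = ip x y * (b : B))
    (hip_pos : ∀ x, 0 ≤ ip x x)
    -- left `𝒜`-module structure
    (lsmul : 𝒜 → X → X)
    (hl_addr : ∀ a x y, lsmul a (x + y) = lsmul a x + lsmul a y)
    (hl_addl : ∀ a a' x, lsmul (a + a') x = lsmul a x + lsmul a' x)
    (hl_mul : ∀ a a' x, lsmul (a * a') x = lsmul a (lsmul a' x))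
    (hl_one : ∀ x, lsmul 1 x = x)
    (hl_smul : ∀ (c : ℂ) (a : 𝒜) (x : X), lsmul (c • a) x = c • lsmul a x)
    -- compatibility of the left action with the inner product
    (hcompat : ∀ (a : 𝒜) (x y : X), ip (lsmul a x) y = ip x (lsmul (star a) y)) :
    ∀ (a : 𝒜) (x : X),
      ip (lsmul a x) (lsmul a x) ≤ ((‖(a : A)‖ ^ 2 : ℂ)) • ip x x := by
  intro a x
  let _ : CStarAlgebra B := {}
  let T : 𝒜 →ₗ[ℝ] B :=
    { toFun := fun b => ip x (lsmul b x)
      map_add' := fun b c => by rw [hl_addl, hip_addr]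
      map_smul' := fun r b => by
        rw [← Complex.coe_smul, hl_smul, hip_smul, RingHom.id_apply, Complex.coe_smul] }
  have hT : ∀ b, T (star b * b) = ip (lsmul b x) (lsmul b x) := fun b => by
    rw [hcompat, ← hl_mul]
    rfl
  have hk : IsSelfAdjoint (algebraMap ℝ 𝒜 (‖(a : A)‖ ^ 2) - star a * a) :=
    ((IsSelfAdjoint.all _).algebraMap 𝒜).sub (IsSelfAdjoint.star_mul_self a)
  have h := map_nonneg_of_forall_neg_isUnit (T := T) (fun b => (hT b).symm ▸ hip_pos _) hk
    fun r hr => StarSubalgebra.isUnit_norm_sq_sub_star_mul_self_sub hspec a hr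
  have h1 : T 1 = ip x x := by
    change ip x (lsmul 1 x) = _
    rw [hl_one]
  rw [map_sub, hT, Algebra.algebraMap_eq_smul_one, map_smul, h1, sub_nonneg] at h
  rwa [← Complex.ofReal_pow, Complex.coe_smul]
end

section
/- Let A and B be C*-algebras and X an (A,B) inner product bimodule: X is a left inner product A-module and a right inner product B-module such that ⟨a·x, y⟩_B = ⟨x, a*·y⟩_B, ₐ⟨x·b, y⟩ = ₐ⟨x, y·b*⟩, and ₐ⟨x,y⟩·z = x·⟨y,z⟩_B for all x,y,z ∈ X, a ∈ A, b ∈ B, and with the left action satisfying the continuity inequality ⟨a·x,a·x⟩_B ≤ ‖a‖²⟨x,x⟩_B. Then for every x ∈ X, ‖ₐ⟨x,x⟩‖_A = ‖⟨x,x⟩_B‖_B; that is, the two module norms ‖x‖_A := ‖ₐ⟨x,x⟩‖^{1/2} and ‖x‖_B := ‖⟨x,x⟩_B‖^{1/2} coincide. -/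
/-- A positive element of norm larger than `r > 0` has a nonzero spectral cut-off `d` above `r`,
on whose support it has an inverse `k` of norm at most `r⁻¹`. -/
theorem exists_spectral_cutoff {A : Type*} [CStarAlgebra A] [PartialOrder A] [StarOrderedRing A]
    (a : A) (ha : 0 ≤ a) (r : ℝ) (hr : 0 < r) (hra : r < ‖a‖) :
    ∃ d k : A, ‖k‖ ≤ r⁻¹ ∧ d * k * a = d ∧ Commute k a ∧ d * (a * star d) ≠ 0 := by
  have hsa : IsSelfAdjoint a := IsSelfAdjoint.of_nonneg ha
  have : Nontrivial A := ⟨⟨a, 0, fun h => by simp [h] at hra; linarith⟩⟩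
  have hmax : ∀ t : ℝ, 0 < max t r := fun t => lt_max_of_lt_right hr
  have hf : Continuous fun t : ℝ => max (t - r) 0 := by fun_prop
  have hg : Continuous fun t : ℝ => (max t r)⁻¹ :=
    (by fun_prop : Continuous fun t : ℝ => max t r).inv₀ fun t => (hmax t).ne'
  have hid' : Continuous fun t : ℝ => t := continuous_id
  have hfg : Continuous fun t : ℝ => max (t - r) 0 * (max t r)⁻¹ := hf.mul hg
  have hidf : Continuous fun t : ℝ => t * max (t - r) 0 := hid'.mul hf
  have hid : cfc (fun t : ℝ => t) a = a := cfc_id' ℝ a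
  refine ⟨cfc (fun t : ℝ => max (t - r) 0) a, cfc (fun t : ℝ => (max t r)⁻¹) a, ?_, ?_,
    ?_, ?_⟩
  · refine norm_cfc_le (by positivity) fun t _ => ?_
    rw [Real.norm_of_nonneg (inv_nonneg.2 (hmax t).le)]
    exact inv_anti₀ hr (le_max_right _ _)
  · nth_rewrite 3 [← hid]
    rw [← cfc_mul _ _ a hf.continuousOn hg.continuousOn,
      ← cfc_mul _ _ a hfg.continuousOn hid'.continuousOn]
    refine cfc_congr fun t _ => ?_
    rcases le_total t r with h | h
    · simp [max_eq_right (sub_nonpos.2 h)]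
    · have : t ≠ 0 := (hr.trans_le h).ne'
      simp [max_eq_left h, this]
  · nth_rewrite 2 [← hid]
    exact cfc_commute_cfc _ _ _
  · have hd : star (cfc (fun t : ℝ => max (t - r) 0) a) = cfc (fun t : ℝ => max (t - r) 0) a :=
      (cfc_predicate _ a : IsSelfAdjoint _)
    rw [hd]
    nth_rewrite 2 [← hid]
    rw [← cfc_mul _ _ a hid'.continuousOn hf.continuousOn,
      ← cfc_mul _ _ a hf.continuousOn hidf.continuousOn]
    intro h0
    have h := norm_apply_le_norm_cfc
      (fun t : ℝ => max (t - r) 0 * (t * max (t - r) 0)) a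
      (CStarAlgebra.norm_mem_spectrum_of_nonneg (a := a) ha)
      (hf.mul hidf).continuousOn
    rw [h0, norm_zero, norm_le_zero_iff, max_eq_left (sub_pos.2 hra).le] at h
    have h1 : 0 < ‖a‖ - r := sub_pos.2 hra
    have h2 : 0 < ‖a‖ := hr.trans hra
    exact (mul_pos h1 (mul_pos h2 h1)).ne' h

/-- A self-adjoint `b` in a C⋆-ring with `‖b * b * b‖ ≤ c ^ 2 * ‖b‖` has norm at most `c`. -/
theorem norm_le_of_norm_cube_le {B : Type*} [NormedRing B] [StarRing B] [CStarRing B]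
    {b : B} (hb : IsSelfAdjoint b) {c : ℝ} (hc : 0 ≤ c)
    (h : ‖b * b * b‖ ≤ c ^ 2 * ‖b‖) : ‖b‖ ≤ c := by
  have hsq : ‖b * b‖ = ‖b‖ ^ 2 := hb.norm_mul_self
  have hbb : IsSelfAdjoint (b * b) := by
    rw [IsSelfAdjoint, star_mul, hb.star_eq]
  have h4 : ‖b * b * (b * b)‖ = ‖b * b‖ ^ 2 := hbb.norm_mul_self
  have h5 : ‖b * b * (b * b)‖ ≤ ‖b * b * b‖ * ‖b‖ := by
    rw [← mul_assoc]
    exact norm_mul_le _ _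
  rcases (norm_nonneg b).eq_or_lt with h0 | h0
  · rwa [← h0]
  · refine le_of_sq_le_sq ?_ hc
    have : ‖b‖ ^ 2 * ‖b‖ ^ 2 ≤ c ^ 2 * ‖b‖ ^ 2 := by
      have := mul_le_mul_of_nonneg_right h h0.le
      rw [h4, hsq] at h5
      nlinarith
    exact le_of_mul_le_mul_right this (by positivity)


/-- For an (A,B) inner product bimodule with the continuity inequality for the
left action, the two module norms coincide: `‖ₐ⟨x,x⟩‖ = ‖⟨x,x⟩_B‖` for every `x`. -/
theorem stmt1
    {A B X : Type*}
    [NormedRing A] [StarRing A] [CStarRing A] [NormedAlgebra ℂ A] [CompleteSpace A]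
    [StarModule ℂ A] [PartialOrder A] [StarOrderedRing A]
    [NormedRing B] [StarRing B] [CStarRing B] [NormedAlgebra ℂ B] [CompleteSpace B]
    [StarModule ℂ B] [PartialOrder B] [StarOrderedRing B]
    [AddCommGroup X] [Module ℂ X]
    -- commuting left A-action and right B-action
    (lsmul : A → X → X) (rsmul : X → B → X)
    (hl_mul : ∀ a a' x, lsmul (a * a') x = lsmul a (lsmul a' x))
    (hr_mul : ∀ x b b', rsmul x (b * b') = rsmul (rsmul x b) b')
    (hcommute : ∀ a x b, rsmul (lsmul a x) b = lsmul a (rsmul x b))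
    -- left A-valued inner product (linear in the first variable)
    (lA : X → X → A)
    (hlA_star : ∀ x y, star (lA x y) = lA y x)
    (hlA_pos : ∀ x, 0 ≤ lA x x)
    (hlA_mod : ∀ a x y, lA (lsmul a x) y = a * lA x y)
    -- right B-valued inner product (linear in the second variable)
    (rB : X → X → B)
    (hrB_star : ∀ x y, star (rB x y) = rB y x)
    (hrB_pos : ∀ x, 0 ≤ rB x x)
    (hrB_mod : ∀ x y b, rB x (rsmul y b) = rB x y * b)
    -- bimodule compatibilities
    (h1 : ∀ (a : A) (x y : X), rB (lsmul a x) y = rB x (lsmul (star a) y))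
    (h2 : ∀ (b : B) (x y : X), lA (rsmul x b) y = lA x (rsmul y (star b)))
    (h3 : ∀ x y z : X, lsmul (lA x y) z = rsmul x (rB y z))
    -- continuity inequality for the left action
    (hcont : ∀ (a : A) (x : X),
      rB (lsmul a x) (lsmul a x) ≤ ((‖a‖ ^ 2 : ℂ)) • rB x x) :
    ∀ x : X, ‖lA x x‖ = ‖rB x x‖ := by
  let : CStarAlgebra A := {}
  let : CStarAlgebra B := {}
  have hcont_norm : ∀ (a : A) (x : X),
      ‖rB (lsmul a x) (lsmul a x)‖ ≤ ‖a‖ ^ 2 * ‖rB x x‖ := fun a x => by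
    refine (CStarAlgebra.norm_le_norm_of_nonneg_of_le (hrB_pos _) (hcont a x)).trans_eq ?_
    simp [norm_smul]
  have hzero : ∀ y, rB y y = 0 → lA y y = 0 := by
    intro y hy
    have hB : rB y (lsmul 0 y) = 0 := by
      have h : rB (lsmul 0 y) (lsmul 0 y) = 0 := by
        simpa [hy] using hcont_norm 0 y
      rwa [h1, star_zero, ← hl_mul, mul_zero] at h
    have hB' : rB (lsmul 0 y) y = 0 := by rw [← hrB_star, hB, star_zero]
    have hA : lA y (lsmul 0 y) = 0 := by rw [← hlA_star, hlA_mod, zero_mul, star_zero]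
    have h0 : lsmul (lA y y) y = lsmul 0 y := by
      have h := h3 y (lsmul 0 y) y
      rw [hA, hB'] at h
      rw [h3, hy, h]
    have hsq : star (lA y y) * lA y y = 0 := by
      rw [hlA_star, ← hlA_mod, h0, hlA_mod, zero_mul]
    exact CStarRing.star_mul_self_eq_zero_iff _ |>.1 hsq
  intro x
  have hpow : ∀ n : ℕ, lsmul (lA x x ^ (n + 1)) x = rsmul x (rB x x ^ (n + 1)) := by
    intro n
    induction n with
    | zero => simpa using h3 x x x
    | succ n ih => rw [pow_succ, hl_mul, h3, ← hcommute, ih, ← hr_mul, ← pow_succ]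
  have hrB_pow : ∀ n : ℕ, rB (lsmul (lA x x ^ (n + 1)) x) (lsmul (lA x x ^ (n + 1)) x)
      = rB x x * rB x x ^ (n + 1) * rB x x ^ (n + 1) := by
    intro n
    rw [h1, star_pow, hlA_star, hpow, ← hcommute, hpow, hrB_mod, hrB_mod]
  apply le_antisymm
  · by_contra! hlt
    obtain ⟨r, hbr, hra⟩ := exists_between hlt
    have hr : 0 < r := (norm_nonneg _).trans_lt hbr
    obtain ⟨d, k, hk, hdk, hcka, hne⟩ :=
      exists_spectral_cutoff (lA x x) (hlA_pos x) r hr hra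
    have hdpow : ∀ n : ℕ, d * k ^ n * lA x x ^ n = d := by
      intro n
      rw [mul_assoc, ← hcka.mul_pow]
      induction n with
      | zero => simp
      | succ n ih => rw [pow_succ, ← mul_assoc, ih, ← mul_assoc, hdk]
    have hbound : ∀ n : ℕ, ‖rB (lsmul d x) (lsmul d x)‖
        ≤ ‖d‖ ^ 2 * ‖rB x x‖ * ((‖rB x x‖ / r) ^ 2) ^ (n + 1) := by
      intro n
      have hk' : ‖k ^ (n + 1)‖ ≤ r⁻¹ ^ (n + 1) :=
        (norm_pow_le' k n.succ_pos).trans (pow_le_pow_left₀ (norm_nonneg _) hk _)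
      have hb' : ‖rB x x ^ (n + 1)‖ ≤ ‖rB x x‖ ^ (n + 1) := norm_pow_le' _ n.succ_pos
      calc ‖rB (lsmul d x) (lsmul d x)‖
          ≤ ‖d * k ^ (n + 1)‖ ^ 2 * ‖rB x x * rB x x ^ (n + 1) * rB x x ^ (n + 1)‖ := by
            have h := hcont_norm (d * k ^ (n + 1)) (lsmul (lA x x ^ (n + 1)) x)
            rwa [← hl_mul, hdpow, hrB_pow] at h
        _ ≤ (‖d‖ * r⁻¹ ^ (n + 1)) ^ 2 *
            (‖rB x x‖ * ‖rB x x‖ ^ (n + 1) * ‖rB x x‖ ^ (n + 1)) := by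
            gcongr
            · exact (norm_mul_le _ _).trans (by gcongr)
            · refine (norm_mul_le _ _).trans ?_
              gcongr
              exact (norm_mul_le _ _).trans (by gcongr)
        _ = ‖d‖ ^ 2 * ‖rB x x‖ * ((‖rB x x‖ / r) ^ 2) ^ (n + 1) := by
            rw [div_eq_mul_inv, pow_right_comm, mul_pow]
            ring
    have hq : (‖rB x x‖ / r) ^ 2 < 1 :=
      pow_lt_one₀ (by positivity) ((div_lt_one hr).2 hbr) two_ne_zero
    have hlim := ((tendsto_pow_atTop_nhds_zero_of_lt_one (by positivity) hq).comp
      (Filter.tendsto_add_atTop_nat 1)).const_mul (‖d‖ ^ 2 * ‖rB x x‖)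
    rw [mul_zero] at hlim
    have hB : rB (lsmul d x) (lsmul d x) = 0 :=
      norm_le_zero_iff.1 (ge_of_tendsto' hlim hbound)
    apply hne
    have hA := hzero _ hB
    rwa [hlA_mod, ← hlA_star, hlA_mod, star_mul, hlA_star] at hA
  · refine norm_le_of_norm_cube_le (hrB_star x x) (norm_nonneg _) ?_
    have h := hcont_norm (lA x x) x
    have h' := hrB_pow 0
    simp only [zero_add, pow_one] at h'
    rwa [h'] at h
end
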